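/- arXiv:1704.07716 — 3 statements merged into one kernel-verified Lean document; each statement's English description precedes it below -/
import Mathlib

section
/- There exists a real constant δ with 0 < δ < 1 such that for every positive integer n with n/2 an even integer and every even integer r with 2 ≤ r ≤ n and r/2 odd, γ(n, n/2, r) ≥ δn. -/
/-- `gammaE n k r` is the minimum cardinality of a family of `r`-element subsets of `[n]`
such that every `k`-bicoloring `B` of `[n]` (identified with its `+1`-class `P`, `|P| = k`)
has an unbiased representative in the family, i.e. some member `A` with
`|A ∩ B(+1)| = |A ∩ B(-1)|`. -/
noncomputable def gammaE (n k r : ℕ) : ℕ :=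
  sInf {m | ∃ 𝒜 : Finset (Finset (Fin n)),
    𝒜.card = m ∧
    (∀ A ∈ 𝒜, A.card = r) ∧
    (∀ P : Finset (Fin n), P.card = k →
      ∃ A ∈ 𝒜, (A ∩ P).card = (A ∩ Pᶜ).card)}

section

open Finset

theorem symmDiff_insert_insert {α : Type*} [DecidableEq α] {a : α} {x y : Finset α}
    (hx : a ∉ x) (hy : a ∉ y) : symmDiff (insert a x) (insert a y) = symmDiff x y := by
  ext b
  simp only [mem_symmDiff, mem_insert]
  grind

theorem symmDiff_insert_left {α : Type*} [DecidableEq α] {a : α} {x y : Finset α}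
    (hy : a ∉ y) : symmDiff (insert a x) y = insert a (symmDiff x y) := by
  ext b
  simp only [mem_symmDiff, mem_insert]
  grind

theorem memberSubfamily_subset_powerset {α : Type*} [DecidableEq α] {a : α} {s : Finset α}
    {A : Finset (Finset α)} (hA : A ⊆ (insert a s).powerset) :
    A.memberSubfamily a ⊆ s.powerset := by
  intro x hx
  rw [mem_memberSubfamily] at hx
  have h1 := hA hx.1
  rw [mem_powerset] at h1 ⊢
  exact (insert_subset_insert_iff hx.2).1 h1

theorem nonMemberSubfamily_subset_powerset {α : Type*} [DecidableEq α] {a : α} {s : Finset α}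
    {A : Finset (Finset α)} (hA : A ⊆ (insert a s).powerset) :
    A.nonMemberSubfamily a ⊆ s.powerset := by
  intro x hx
  rw [mem_nonMemberSubfamily] at hx
  have h1 := hA hx.1
  rw [mem_powerset] at h1 ⊢
  exact (subset_insert_iff_of_notMem hx.2).1 h1

theorem add_mul_add_le_of_mul_le {q C x y S T : ℝ} (hq : 1 ≤ q) (hx : 0 < x) (hyx : y ≤ x)
    (hxy : x ≤ q * y) (hS : x * S ≤ C) (hT : y * T ≤ C) (hC : 0 ≤ C) :
    (x + y) * (S + T) ≤ C * ((1 + q) ^ 2 / q) := by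
  have hq0 : 0 < q := by linarith
  have hy : 0 < y := by
    by_contra h
    nlinarith
  have h1 : S ≤ C / x := by rw [le_div_iff₀ hx]; linarith
  have h2 : T ≤ C / y := by rw [le_div_iff₀ hy]; linarith
  calc (x + y) * (S + T) ≤ (x + y) * (C / x + C / y) := by gcongr
    _ = C * ((x + y) ^ 2 / (x * y)) := by field_simp; ring
    _ ≤ C * ((1 + q) ^ 2 / q) := by
      gcongr C * ?_
      rw [div_le_div_iff₀ (by positivity) hq0]
      nlinarith [mul_nonneg (sub_nonneg.2 hxy)
        (sub_nonneg.2 (hyx.trans (le_mul_of_one_le_left hx.le hq)))]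

theorem add_mul_add_mul_le_of_mul_le {q C x y S : ℝ} (hq : 1 ≤ q)
    (hxy : q * y ≤ x) (hS : x * S ≤ C) (hS0 : 0 ≤ S) :
    (x + y) * (S + q * S) ≤ C * ((1 + q) ^ 2 / q) := by
  have hq0 : 0 < q := by linarith
  rw [← mul_div_assoc, le_div_iff₀ hq0]
  have h1 : 0 ≤ S * (1 + q) * (x - q * y) := by
    have : 0 ≤ x - q * y := by linarith
    positivity
  have h2 : (1 + q) ^ 2 * (x * S) ≤ (1 + q) ^ 2 * C := by gcongr
  nlinarith

/-- A nonempty family `A` of subsets of `s` has many subsets of `s` close to it: there is an upper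
bound `d` for the Hamming distance to `A` with small exponential moment. -/
theorem exists_dist_bound {α : Type*} [DecidableEq α] {q : ℝ} (hq : 1 ≤ q) (s : Finset α) :
    ∀ A : Finset (Finset α), A ⊆ s.powerset → A.Nonempty →
      ∃ d : Finset α → ℕ, (∀ x ∈ s.powerset, ∃ a ∈ A, (symmDiff x a).card ≤ d x) ∧
        (A.card : ℝ) * ∑ x ∈ s.powerset, q ^ d x ≤ ((1 + q) ^ 2 / q) ^ s.card := by
  have hq0 : 0 < q := by linarith
  induction s using Finset.induction_on with
  | empty =>
    intro A hA hne
    have : A = {∅} := by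
      apply Finset.Subset.antisymm (by simpa using hA)
      obtain ⟨a, ha⟩ := hne
      have := hA ha
      simp at this
      subst this
      simpa using ha
    subst this
    exact ⟨fun _ => 0, by simp, by simp⟩
  | insert a s has ih =>
    intro A hA hne
    have hsub0 := nonMemberSubfamily_subset_powerset hA
    have hsub1 := memberSubfamily_subset_powerset hA
    have hcard := card_memberSubfamily_add_card_nonMemberSubfamily a A
    have hcardR : ((A.memberSubfamily a).card : ℝ) + (A.nonMemberSubfamily a).card = A.card := by
      exact_mod_cast hcard
    have hApos := hne.card_pos
    have key : ∀ X Y : Finset (Finset α), X ⊆ s.powerset → Y ⊆ s.powerset → Y.card ≤ X.card →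
        0 < X.card → ∃ dX dY : Finset α → ℕ,
        (∀ x ∈ s.powerset, ∃ a ∈ X, (symmDiff x a).card ≤ dX x) ∧
        (∀ x ∈ s.powerset, (∃ a ∈ Y, (symmDiff x a).card ≤ dY x) ∨
          (∃ a ∈ X, (symmDiff x a).card + 1 ≤ dY x)) ∧
        ((X.card : ℝ) + Y.card) * (∑ x ∈ s.powerset, q ^ dX x + ∑ x ∈ s.powerset, q ^ dY x) ≤
          ((1 + q) ^ 2 / q) ^ (insert a s).card := by
      intro X Y hX hY hYX hXpos
      have hXposR : (0 : ℝ) < X.card := by exact_mod_cast hXpos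
      have hYXR : (Y.card : ℝ) ≤ X.card := by exact_mod_cast hYX
      obtain ⟨d, hd, hdc⟩ := ih X hX (card_pos.1 hXpos)
      rw [card_insert_of_notMem has, pow_succ]
      rcases le_total ((X.card : ℝ)) (q * Y.card) with h | h
      · have hYpos : 0 < Y.card := by
          by_contra h0
          have : Y.card = 0 := by omega
          rw [this] at h
          simp only [Nat.cast_zero, mul_zero] at h
          linarith
        obtain ⟨d', hd', hdc'⟩ := ih Y hY (card_pos.1 hYpos)
        exact ⟨d, d', hd, fun x hx => Or.inl (hd' x hx),
          add_mul_add_le_of_mul_le hq hXposR hYXR h hdc hdc' (by positivity)⟩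
      · refine ⟨d, fun x => d x + 1, hd, fun x hx => Or.inr ?_, ?_⟩
        · obtain ⟨b, hb, hb'⟩ := hd x hx
          exact ⟨b, hb, by simpa using hb'⟩
        · simp only [pow_succ' q, ← mul_sum]
          exact add_mul_add_mul_le_of_mul_le hq h hdc (by positivity)
    have hmem : ∀ x ∈ s.powerset, a ∉ x := fun x hx hax => has (mem_powerset.1 hx hax)
    have assemble : ∀ d0 d1 : Finset α → ℕ,
        (∀ x ∈ s.powerset, (∃ y ∈ A.nonMemberSubfamily a, (symmDiff x y).card ≤ d0 x) ∨
          (∃ y ∈ A.memberSubfamily a, (symmDiff x y).card + 1 ≤ d0 x)) →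
        (∀ x ∈ s.powerset, (∃ y ∈ A.memberSubfamily a, (symmDiff x y).card ≤ d1 x) ∨
          (∃ y ∈ A.nonMemberSubfamily a, (symmDiff x y).card + 1 ≤ d1 x)) →
        (A.card : ℝ) * (∑ x ∈ s.powerset, q ^ d0 x + ∑ x ∈ s.powerset, q ^ d1 x) ≤
          ((1 + q) ^ 2 / q) ^ (insert a s).card →
        ∃ d : Finset α → ℕ, (∀ x ∈ (insert a s).powerset, ∃ a ∈ A, (symmDiff x a).card ≤ d x) ∧
        (A.card : ℝ) * ∑ x ∈ (insert a s).powerset, q ^ d x ≤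
          ((1 + q) ^ 2 / q) ^ (insert a s).card := by
      intro d0 d1 h0 h1 hsum
      refine ⟨fun x => if a ∈ x then d1 (x.erase a) else d0 x, ?_, ?_⟩
      · intro x hx
        by_cases hax : a ∈ x
        · simp only [hax, if_true]
          have hx' : x.erase a ∈ s.powerset := by
            rw [mem_powerset] at hx ⊢
            rwa [← subset_insert_iff]
          have hxe : insert a (x.erase a) = x := insert_erase hax
          rcases h1 _ hx' with ⟨y, hy, hyd⟩ | ⟨y, hy, hyd⟩
          · rw [mem_memberSubfamily] at hy
            refine ⟨_, hy.1, ?_⟩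
            rw [← hxe, symmDiff_insert_insert (notMem_erase a x) hy.2]
            simpa using hyd
          · rw [mem_nonMemberSubfamily] at hy
            refine ⟨_, hy.1, ?_⟩
            nth_rewrite 1 [← hxe]
            rw [symmDiff_insert_left hy.2]
            exact (card_insert_le _ _).trans hyd
        · simp only [hax, if_false]
          have hx' : x ∈ s.powerset := by
            rw [mem_powerset] at hx ⊢
            exact (subset_insert_iff_of_notMem hax).1 hx
          rcases h0 _ hx' with ⟨y, hy, hyd⟩ | ⟨y, hy, hyd⟩
          · rw [mem_nonMemberSubfamily] at hy
            exact ⟨_, hy.1, hyd⟩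
          · rw [mem_memberSubfamily] at hy
            refine ⟨_, hy.1, ?_⟩
            rw [symmDiff_comm, symmDiff_insert_left hax, symmDiff_comm]
            exact (card_insert_le _ _).trans hyd
      · rw [sum_powerset_insert has]
        refine le_of_eq_of_le ?_ hsum
        congr 2
        · exact sum_congr rfl fun x hx => by simp [hmem x hx]
        · exact sum_congr rfl fun x hx => by simp [hmem x hx]
    rcases le_total (A.memberSubfamily a).card (A.nonMemberSubfamily a).card with h | h
    · obtain ⟨d0, d1, h0, h1, hs⟩ := key _ _ hsub0 hsub1 h (by omega)
      refine assemble d0 d1 (fun x hx => Or.inl (h0 x hx)) h1 ?_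
      rwa [← hcardR, add_comm ((A.memberSubfamily a).card : ℝ)]
    · obtain ⟨d1, d0, h1, h0, hs⟩ := key _ _ hsub1 hsub0 h (by omega)
      refine assemble d0 d1 h0 (fun x hx => Or.inl (h1 x hx)) ?_
      rwa [← hcardR, add_comm (∑ x ∈ s.powerset, q ^ d0 x)]

theorem card_filter_dist_mul_le {α : Type*} [DecidableEq α] {q : ℝ} (hq : 1 ≤ q) {s : Finset α}
    {A : Finset (Finset α)} (hA : A ⊆ s.powerset) (hne : A.Nonempty) (κ : ℕ) :
    ((s.powerset.filter fun x => ∀ a ∈ A, κ < (symmDiff x a).card).card : ℝ) * q ^ κ * A.card ≤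
      ((1 + q) ^ 2 / q) ^ s.card := by
  obtain ⟨d, hd, hs⟩ := exists_dist_bound hq s A hA hne
  have hq0 : 0 < q := by linarith
  refine le_trans ?_ hs
  rw [mul_comm]
  gcongr
  rw [← nsmul_eq_mul]
  refine (card_nsmul_le_sum _ (fun x => q ^ d x) _ ?_).trans
    (sum_le_sum_of_subset_of_nonneg (filter_subset _ _) fun _ _ _ => by positivity)
  intro x hx
  rw [mem_filter] at hx
  obtain ⟨a, ha, hxa⟩ := hd x hx.1
  exact pow_le_pow_right₀ hq ((hx.2 a ha).le.trans hxa)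

theorem card_sdiff_le_add_card_symmDiff {α : Type*} [DecidableEq α] (x y z : Finset α) :
    (x \ z).card ≤ (y \ z).card + (symmDiff x y).card := by
  refine (card_le_card ?_).trans (card_union_le _ _)
  intro b
  simp only [mem_sdiff, mem_union, mem_symmDiff]
  tauto

theorem card_sdiff_symmDiff_sdiff {α : Type*} [DecidableEq α] {s x z : Finset α}
    (hx : x ⊆ s) : (symmDiff x (s \ z) \ z).card + (x \ z).card = (s \ z).card := by
  rw [← card_union_of_disjoint]
  · congr 1
    ext b
    have := @hx b
    simp only [mem_union, mem_sdiff, mem_symmDiff]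
    tauto
  · rw [disjoint_left]
    intro b
    simp only [mem_sdiff, mem_symmDiff]
    tauto

/-- The two closed halves of the cube cut at the middle of `|x \ z|` have density at least `1/2`. -/
theorem two_pow_card_le_two_mul_card_filter {α : Type*} [DecidableEq α] {s z : Finset α}
    {l : ℕ} (hl : (s \ z).card = 2 * l) :
    2 ^ s.card ≤ 2 * (s.powerset.filter fun x => l ≤ (x \ z).card).card ∧
      2 ^ s.card ≤ 2 * (s.powerset.filter fun x => (x \ z).card ≤ l).card := by
  have hmem : ∀ x ∈ s.powerset, symmDiff x (s \ z) ∈ s.powerset := by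
    intro x hx
    rw [mem_powerset] at hx ⊢
    intro b
    have := @hx b
    simp only [mem_sdiff, mem_symmDiff]
    tauto
  have hinj : Function.Injective fun x : Finset α => symmDiff x (s \ z) :=
    symmDiff_left_injective _
  have h1 : (s.powerset.filter fun x => l ≤ (x \ z).card).card ≤
      (s.powerset.filter fun x => (x \ z).card ≤ l).card := by
    refine card_le_card_of_injOn _ ?_ hinj.injOn
    intro x hx
    simp only [coe_filter, Set.mem_ofPred_eq] at hx ⊢
    have := card_sdiff_symmDiff_sdiff (z := z) (mem_powerset.1 hx.1)
    exact ⟨hmem x hx.1, by omega⟩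
  have h2 : (s.powerset.filter fun x => (x \ z).card ≤ l).card ≤
      (s.powerset.filter fun x => l ≤ (x \ z).card).card := by
    refine card_le_card_of_injOn _ ?_ hinj.injOn
    intro x hx
    simp only [coe_filter, Set.mem_ofPred_eq] at hx ⊢
    have := card_sdiff_symmDiff_sdiff (z := z) (mem_powerset.1 hx.1)
    exact ⟨hmem x hx.1, by omega⟩
  have h3 : 2 ^ s.card ≤ (s.powerset.filter fun x => l ≤ (x \ z).card).card +
      (s.powerset.filter fun x => (x \ z).card ≤ l).card := by
    rw [← card_powerset]
    refine (card_le_card ?_).trans (card_union_le _ _)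
    intro x hx
    simp only [mem_union, mem_filter, hx, true_and]
    exact le_total _ _
  omega

/-- Two dense families contain members close to a set `x` and to its translate by `z`, where
moreover `x \ z` has nearly the expected size. -/
theorem exists_near_translate {α : Type*} [DecidableEq α] {q : ℝ} (hq : 1 ≤ q) {s z : Finset α}
    (hz : z ⊆ s) {l κ : ℕ} (hl : (s \ z).card = 2 * l) {A B : Finset (Finset α)}
    (hA : A ⊆ s.powerset) (hB : B ⊆ s.powerset)
    (hAc : 8 * ((1 + q) ^ 2 / q) ^ s.card < 2 ^ s.card * A.card * q ^ κ)
    (hBc : 8 * ((1 + q) ^ 2 / q) ^ s.card < 2 ^ s.card * B.card * q ^ κ) :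
    ∃ x, ∃ a ∈ A, ∃ b ∈ B, (symmDiff x a).card ≤ κ ∧ (symmDiff (symmDiff x z) b).card ≤ κ ∧
      l ≤ (x \ z).card + κ ∧ (x \ z).card ≤ l + κ := by
  have hq0 : 0 < q := by linarith
  set C := ((1 + q) ^ 2 / q) ^ s.card with hC
  have hC0 : 0 < C := by positivity
  have h2 : (0 : ℝ) < 2 ^ s.card := by positivity
  have hbad : ∀ D : Finset (Finset α), D ⊆ s.powerset →
      4 * C < 2 ^ s.card * D.card * q ^ κ →
      4 * ((s.powerset.filter fun x => ∀ a ∈ D, κ < (symmDiff x a).card).card : ℝ) <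
        2 ^ s.card := by
    intro D hD hDc
    have hne : D.Nonempty := by
      rw [nonempty_iff_ne_empty]
      rintro rfl
      simp at hDc
      linarith
    have hpos : (0 : ℝ) < D.card := by exact_mod_cast hne.card_pos
    have h := card_filter_dist_mul_le hq hD hne κ
    have hqk : 0 < q ^ κ * D.card := by positivity
    by_contra hcon
    push Not at hcon
    have := mul_le_mul_of_nonneg_right hcon hqk.le
    rw [← hC] at h
    nlinarith
  have hAle : (A.card : ℝ) ≤ 2 ^ s.card := by
    have := card_le_card hA
    rw [card_powerset] at this
    exact_mod_cast this
  have hhalf : 8 * C < 2 ^ s.card * 2 ^ s.card * q ^ κ := by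
    refine hAc.trans_le ?_
    gcongr
  have hbadhalf : ∀ D : Finset (Finset α), D ⊆ s.powerset → 2 ^ s.card ≤ 2 * D.card →
      4 * ((s.powerset.filter fun x => ∀ a ∈ D, κ < (symmDiff x a).card).card : ℝ) <
        2 ^ s.card := by
    intro D hD hDc
    apply hbad D hD
    have : (2 : ℝ) ^ s.card ≤ 2 * D.card := by exact_mod_cast hDc
    have h3 : (2 : ℝ) ^ s.card * 2 ^ s.card * q ^ κ ≤ 2 ^ s.card * (2 * D.card) * q ^ κ := by
      gcongr
    nlinarith
  obtain ⟨hup, hdown⟩ := two_pow_card_le_two_mul_card_filter hl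
  have hb1 := hbad A hA (by linarith)
  have hBcard : (B.image fun b => symmDiff b z).card = B.card :=
    card_image_of_injective _ (symmDiff_left_injective _)
  have hb2 := hbad (B.image fun b => symmDiff b z) (by
    intro y hy
    rw [mem_image] at hy
    obtain ⟨b, hb, rfl⟩ := hy
    rw [mem_powerset]
    exact symmDiff_le (le_sup_of_le_right (mem_powerset.1 (hB hb))) (le_sup_of_le_right hz))
    (by rw [hBcard]; linarith)
  have hb3 := hbadhalf _ (filter_subset _ _) hup
  have hb4 := hbadhalf _ (filter_subset _ _) hdown
  set S1 := s.powerset.filter fun x => ∀ a ∈ A, κ < (symmDiff x a).card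
  set S2 := s.powerset.filter fun x => ∀ a ∈ B.image fun b => symmDiff b z,
    κ < (symmDiff x a).card
  set S3 := s.powerset.filter fun x => ∀ a ∈ s.powerset.filter fun x => l ≤ (x \ z).card,
    κ < (symmDiff x a).card
  set S4 := s.powerset.filter fun x => ∀ a ∈ s.powerset.filter fun x => (x \ z).card ≤ l,
    κ < (symmDiff x a).card
  have hex : ∃ x ∈ s.powerset, x ∉ S1 ∪ S2 ∪ S3 ∪ S4 := by
    by_contra hcon
    push Not at hcon
    have h5 : s.powerset.card ≤ S1.card + S2.card + S3.card + S4.card :=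
      (card_le_card hcon).trans ((card_union_le _ _).trans (by
        have := card_union_le (S1 ∪ S2) S3
        have := card_union_le S1 S2
        omega))
    rw [card_powerset] at h5
    have h6 : (2 : ℝ) ^ s.card ≤ S1.card + S2.card + S3.card + S4.card := by exact_mod_cast h5
    linarith
  obtain ⟨x, hxs, hx⟩ := hex
  simp only [S1, S2, S3, S4, mem_union, mem_filter, hxs, true_and, not_or, not_forall, not_lt,
    exists_prop, mem_image] at hx
  obtain ⟨⟨⟨⟨a, ha, hxa⟩, ⟨_, ⟨b, hb, rfl⟩, hxb⟩⟩, ⟨u, ⟨-, hu⟩, hxu⟩⟩, ⟨v, ⟨-, hv⟩, hxv⟩⟩ := hx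
  refine ⟨x, a, ha, b, hb, hxa, ?_, ?_, ?_⟩
  · rwa [symmDiff_right_comm, symmDiff_assoc]
  · have := card_sdiff_le_add_card_symmDiff u x z
    rw [symmDiff_comm] at this
    omega
  · have := card_sdiff_le_add_card_symmDiff x v z
    omega

/-- Families avoiding a long interval of intersection sizes cannot both be dense. -/
theorem card_mul_card_le_of_avoids_long {α : Type*} [DecidableEq α] {q : ℝ} (hq : 1 ≤ q)
    {s : Finset α} {l κ : ℕ} (hκ : 6 * κ ≤ l) (hls : 2 * l ≤ s.card) {A B : Finset (Finset α)}
    (hA : A ⊆ s.powerset) (hB : B ⊆ s.powerset)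
    (h : ∀ a ∈ A, ∀ b ∈ B, l ≤ (a ∩ b).card + 6 * κ → l < (a ∩ b).card) :
    (A.card : ℝ) * B.card ≤ 4 ^ s.card * (8 * ((1 + q) ^ 2 / (4 * q)) ^ s.card / q ^ κ) := by
  have hq0 : 0 < q := by linarith
  have hbound : ∀ D : Finset (Finset α), D ⊆ s.powerset → (D.card : ℝ) ≤ 2 ^ s.card := by
    intro D hD
    have := card_le_card hD
    rw [card_powerset] at this
    exact_mod_cast this
  have hA' := hbound A hA
  have hB' := hbound B hB
  have hCeq : (4 : ℝ) ^ s.card * (8 * ((1 + q) ^ 2 / (4 * q)) ^ s.card / q ^ κ) =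
      8 * ((1 + q) ^ 2 / q) ^ s.card / q ^ κ := by
    have : 4 * ((1 + q) ^ 2 / (4 * q)) = (1 + q) ^ 2 / q := by field_simp
    rw [← mul_div_assoc, mul_left_comm, ← mul_pow, this]
  rw [hCeq, le_div_iff₀ (by positivity)]
  have hqk : 0 < q ^ κ := by positivity
  by_contra hcon
  push Not at hcon
  obtain ⟨z, hz, hzc⟩ := exists_subset_card_eq (s := s) (n := s.card - 2 * (l - 3 * κ)) (by omega)
  have hsz : (s \ z).card = 2 * (l - 3 * κ) := by
    rw [card_sdiff_of_subset hz]
    omega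
  obtain ⟨x, a, ha, b, hb, hxa, hxb, hx1, hx2⟩ := exists_near_translate (κ := κ) hq hz hsz hA hB
    (hcon.trans_le (by
      rw [mul_comm ((2 : ℝ) ^ s.card)]
      gcongr))
    (hcon.trans_le (by gcongr))
  have h1 : (a ∩ b).card ≤ (x \ z).card + (symmDiff x a).card +
      (symmDiff (symmDiff x z) b).card := by
    refine (card_le_card ?_).trans ((card_union_le ((x \ z) ∪ symmDiff x a) _).trans
      (Nat.add_le_add_right (card_union_le _ _) _))
    intro c
    simp only [mem_inter, mem_union, mem_sdiff, mem_symmDiff]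
    tauto
  have h2 : (x \ z).card ≤ (a ∩ b).card + (symmDiff x a).card +
      (symmDiff (symmDiff x z) b).card := by
    refine (card_le_card ?_).trans ((card_union_le ((a ∩ b) ∪ symmDiff x a) _).trans
      (Nat.add_le_add_right (card_union_le _ _) _))
    intro c
    simp only [mem_inter, mem_union, mem_sdiff, mem_symmDiff]
    tauto
  have := h a ha b hb (by omega)
  omega

theorem normalized_density_alternative {β p r x y : ℝ} (hβ : 0 < β) (hβ' : β ≤ 1 / 10)
    (hp : 0 ≤ p) (hr : 0 ≤ r) (hp1 : 0 ≤ 1 - p)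
    (h1 : (1 + p) * (1 + y) < 1 + β) (h2 : (1 + x) * (1 + r) < 1 + β)
    (h3 : (1 - x) * (1 - y) < 1 + β) (h4 : (1 - p) * (1 - y) < 1 - 4 * β)
    (h5 : (1 - x) * (1 - r) < 1 - 4 * β) : False := by
  rcases le_or_gt 0 y with hy | hy
  · have h6 : p < β := by nlinarith only [h1, mul_nonneg hp hy, hy]
    have h7 : y < β := by nlinarith only [h1, mul_nonneg hp hy, hp]
    nlinarith only [h4, h6, h7, mul_nonneg hp hy, hβ]
  rcases le_or_gt 0 x with hx | hx
  · have h6 : r < β := by nlinarith only [h2, mul_nonneg hr hx, hx]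
    have h7 : x < β := by nlinarith only [h2, mul_nonneg hr hx, hr]
    nlinarith only [h5, h6, h7, mul_nonneg hr hx, hβ]
  have h6 : -y < β := by nlinarith only [h3, mul_pos_of_neg_of_neg hx hy, hx]
  have h7 : (1 + p) * (1 - β) < 1 + β := by nlinarith only [h1, hp, h6]
  have h8 : p < 4 * β := by nlinarith only [h7, hp, hβ, hβ']
  nlinarith only [h4, h8, hp1, hy]

theorem density_alternative {β u i f₀ f₁ v j g₀ g₁ F G : ℝ} (hβ : 0 < β) (hβ' : β ≤ 1 / 10)
    (hloss : 1 ≤ (1 - 4 * β) * (1 + β) ^ 5)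
    (hF : 0 ≤ F) (hG : 0 ≤ G) (hui : u + i = F) (hf : f₁ + f₀ = F) (hvj : v + j = G)
    (hg : g₁ + g₀ = G) (hi : 0 ≤ i) (hiu : i ≤ u) (hj : 0 ≤ j) (hjv : j ≤ v)
    (hg₀ : 0 ≤ g₀) :
    (1 + β) * (F * G) ≤ 4 * (u * g₀) ∨ (1 + β) * (F * G) ≤ 4 * (f₀ * v) ∨
      (1 + β) * (F * G) ≤ 4 * (f₁ * g₁) ∨ F * G ≤ (1 + β) ^ 5 * (4 * (i * g₁)) ∨
      F * G ≤ (1 + β) ^ 5 * (4 * (f₁ * j)) := by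
  by_contra hcon
  push Not at hcon
  obtain ⟨h1, h2, h3, h4, h5⟩ := hcon
  have hu : 0 ≤ u := hi.trans hiu
  have hF' : 0 < F := by
    rcases hF.lt_or_eq with h | h
    · exact h
    · have : 0 ≤ u * g₀ := by positivity
      rw [← h] at h1
      linarith
  have hG' : 0 < G := by
    rcases hG.lt_or_eq with h | h
    · exact h
    · have : 0 ≤ u * g₀ := by positivity
      rw [← h] at h1
      linarith
  have hFG : 0 < F * G := by positivity
  have hb5 : 0 < (1 + β) ^ 5 := by positivity
  have hloss' : ∀ w, F * G > (1 + β) ^ 5 * w → w < (1 - 4 * β) * (F * G) := by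
    intro w hw
    have : F * G ≤ (1 + β) ^ 5 * ((1 - 4 * β) * (F * G)) := by
      nlinarith only [mul_le_mul_of_nonneg_right hloss hFG.le]
    exact lt_of_mul_lt_mul_left (hw.trans_le this) hb5.le
  replace h4 := hloss' _ h4
  replace h5 := hloss' _ h5
  obtain ⟨p, rfl⟩ : ∃ p, u = F * (1 + p) / 2 := ⟨2 * u / F - 1, by field_simp; ring⟩
  obtain ⟨r, rfl⟩ : ∃ p, v = G * (1 + p) / 2 := ⟨2 * v / G - 1, by field_simp; ring⟩
  obtain ⟨x, rfl⟩ : ∃ p, f₀ = F * (1 + p) / 2 := ⟨2 * f₀ / F - 1, by field_simp; ring⟩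
  obtain ⟨y, rfl⟩ : ∃ p, g₀ = G * (1 + p) / 2 := ⟨2 * g₀ / G - 1, by field_simp; ring⟩
  obtain rfl : i = F * (1 - p) / 2 := by linarith
  obtain rfl : j = G * (1 - r) / 2 := by linarith
  obtain rfl : f₁ = F * (1 - x) / 2 := by linarith
  obtain rfl : g₁ = G * (1 - y) / 2 := by linarith
  have hp : 0 ≤ p := (mul_nonneg_iff_of_pos_left hF').1 (by linarith only [hiu])
  have hr : 0 ≤ r := (mul_nonneg_iff_of_pos_left hG').1 (by linarith only [hjv])
  have hp1 : 0 ≤ 1 - p := (mul_nonneg_iff_of_pos_left hF').1 (by linarith only [hi])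
  replace h1 : (1 + p) * (1 + y) < 1 + β := by
    refine lt_of_mul_lt_mul_left ?_ hFG.le
    linarith only [h1]
  replace h2 : (1 + x) * (1 + r) < 1 + β := by
    refine lt_of_mul_lt_mul_left ?_ hFG.le
    linarith only [h2]
  replace h3 : (1 - x) * (1 - y) < 1 + β := by
    refine lt_of_mul_lt_mul_left ?_ hFG.le
    linarith only [h3]
  replace h4 : (1 - p) * (1 - y) < 1 - 4 * β := by
    refine lt_of_mul_lt_mul_left ?_ hFG.le
    linarith only [h4]
  replace h5 : (1 - x) * (1 - r) < 1 - 4 * β := by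
    refine lt_of_mul_lt_mul_left ?_ hFG.le
    linarith only [h5]
  exact normalized_density_alternative hβ hβ' hp hr hp1 h1 h2 h3 h4 h5

/-- The upper bound for the product of the densities of two families which avoid an interval of
intersection sizes, `k` coordinates before the ground set gets too small and `u` steps before the
interval is long. -/
noncomputable def avoidBound (β K : ℝ) (k u : ℕ) : ℝ :=
  K * (1 + β) ^ (5 * u) + (1 + β) ^ (6 * u) / (1 + β) ^ k

theorem avoidBound_le_mul_succ {β K : ℝ} (hβ : 0 ≤ β) (hK : 0 ≤ K) (k u : ℕ) :
    avoidBound β K k u ≤ (1 + β) * avoidBound β K (k + 1) u := by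
  unfold avoidBound
  have h : (1 + β) ^ (6 * u) / (1 + β) ^ k =
      (1 + β) * ((1 + β) ^ (6 * u) / (1 + β) ^ (k + 1)) := by
    field_simp
    ring
  have h2 : 0 ≤ β * (K * (1 + β) ^ (5 * u)) := by positivity
  rw [mul_add, ← h]
  linarith

theorem pow_mul_avoidBound {β K : ℝ} (hβ : 0 ≤ β) (k u : ℕ) :
    (1 + β) ^ 5 * avoidBound β K k u = avoidBound β K (k + 1) (u + 1) := by
  unfold avoidBound
  have hb : 0 < 1 + β := by linarith
  field_simp
  ring

theorem card_mul_card_le_avoidBound {α : Type*} [DecidableEq α] {β q K : ℝ} {N₀ n κ : ℕ}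
    (hβ : 0 < β) (hβ' : β ≤ 1 / 10) (hloss : 1 ≤ (1 - 4 * β) * (1 + β) ^ 5) (hq : 1 ≤ q)
    (hK : ∀ N ≤ n, 8 * ((1 + q) ^ 2 / (4 * q)) ^ N / q ^ κ ≤ K) (s : Finset α) :
    ∀ A B : Finset (Finset α), A ⊆ s.powerset → B ⊆ s.powerset → ∀ l e u : ℕ,
      N₀ ≤ s.card → s.card ≤ n → e + u = 6 * κ → 6 * κ + s.card ≤ l + N₀ → 2 * l ≤ N₀ →
      (∀ a ∈ A, ∀ b ∈ B, l ≤ (a ∩ b).card + e → l < (a ∩ b).card) →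
      (A.card : ℝ) * B.card ≤ 4 ^ s.card * avoidBound β K (s.card - N₀) u := by
  have hK0 : 0 ≤ K := le_trans (by positivity) (hK 0 (Nat.zero_le n))
  have trivial_bound : ∀ (s : Finset α) (A B : Finset (Finset α)) (u : ℕ), A ⊆ s.powerset →
      B ⊆ s.powerset → s.card = N₀ →
      (A.card : ℝ) * B.card ≤ 4 ^ s.card * avoidBound β K (s.card - N₀) u := by
    intro s A B u hA hB hs
    have hbound : ∀ D : Finset (Finset α), D ⊆ s.powerset → (D.card : ℝ) ≤ 2 ^ s.card := by
      intro D hD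
      have := card_le_card hD
      rw [card_powerset] at this
      exact_mod_cast this
    have h4 : (4 : ℝ) ^ s.card = 2 ^ s.card * 2 ^ s.card := by
      rw [← mul_pow]
      norm_num
    have h1 : 1 ≤ avoidBound β K (s.card - N₀) u := by
      unfold avoidBound
      rw [hs, Nat.sub_self, pow_zero, div_one]
      have : 1 ≤ (1 + β) ^ (6 * u) := one_le_pow₀ (by linarith)
      have : 0 ≤ K * (1 + β) ^ (5 * u) := by positivity
      linarith
    calc (A.card : ℝ) * B.card ≤ 2 ^ s.card * 2 ^ s.card :=
          mul_le_mul (hbound A hA) (hbound B hB) (by positivity) (by positivity)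
      _ = 4 ^ s.card := h4.symm
      _ ≤ _ := le_mul_of_one_le_right (by positivity) h1
  induction s using Finset.induction_on with
  | empty =>
    intro A B hA hB l e u hN _ _ _ _ _
    exact trivial_bound _ _ _ _ hA hB (by simp at hN ⊢; omega)
  | insert a s has ih =>
    intro A B hA hB l e u hN hn heu hl hlN havoid
    by_cases hcard : (insert a s).card = N₀
    · exact trivial_bound _ _ _ _ hA hB hcard
    obtain _ | u := u
    · have h6 : e = 6 * κ := by omega
      subst h6
      refine (card_mul_card_le_of_avoids_long hq (by omega) (by omega) hA hB havoid).trans ?_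
      refine mul_le_mul_of_nonneg_left ((hK _ hn).trans ?_) (by positivity)
      unfold avoidBound
      have : 0 ≤ (1 + β) ^ (6 * 0) / (1 + β) ^ ((insert a s).card - N₀) := by positivity
      simpa using this
    have hA0 := nonMemberSubfamily_subset_powerset hA
    have hA1 := memberSubfamily_subset_powerset hA
    have hB0 := nonMemberSubfamily_subset_powerset hB
    have hB1 := memberSubfamily_subset_powerset hB
    set A0 := A.nonMemberSubfamily a with hA0d
    set A1 := A.memberSubfamily a with hA1d
    set B0 := B.nonMemberSubfamily a with hB0d
    set B1 := B.memberSubfamily a with hB1d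
    rw [card_insert_of_notMem has] at hN hn hl hcard ⊢
    have hk : s.card + 1 - N₀ = (s.card - N₀) + 1 := by omega
    rw [hk]
    have hinter : ∀ x y : Finset α, a ∉ x → (insert a x ∩ insert a y).card = (x ∩ y).card + 1 := by
      intro x y hx
      rw [← insert_inter_distrib, card_insert_of_notMem fun h => hx (mem_inter.1 h).1]
    have avoid00 : ∀ x ∈ A0, ∀ y ∈ B0, l ≤ (x ∩ y).card + e → l < (x ∩ y).card := by
      intro x hx y hy
      rw [mem_nonMemberSubfamily] at hx hy
      exact havoid x hx.1 y hy.1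
    have avoid10 : ∀ x ∈ A1, ∀ y ∈ B0, l ≤ (x ∩ y).card + e → l < (x ∩ y).card := by
      intro x hx y hy
      rw [mem_nonMemberSubfamily] at hy
      rw [mem_memberSubfamily] at hx
      have := havoid _ hx.1 y hy.1
      rwa [insert_inter_of_notMem hy.2] at this
    have avoid01 : ∀ x ∈ A0, ∀ y ∈ B1, l ≤ (x ∩ y).card + e → l < (x ∩ y).card := by
      intro x hx y hy
      rw [mem_nonMemberSubfamily] at hx
      rw [mem_memberSubfamily] at hy
      have := havoid x hx.1 _ hy.1
      rwa [inter_insert_of_notMem hx.2] at this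
    have avoid11 : ∀ x ∈ A1, ∀ y ∈ B1, l ≤ (x ∩ y).card + 1 + e → l < (x ∩ y).card + 1 := by
      intro x hx y hy
      rw [mem_memberSubfamily] at hx hy
      have := havoid _ hx.1 _ hy.1
      rwa [hinter x y hx.2] at this
    have cA : ((A1.card : ℝ)) + A0.card = A.card := by
      exact_mod_cast card_memberSubfamily_add_card_nonMemberSubfamily a A
    have cB : ((B1.card : ℝ)) + B0.card = B.card := by
      exact_mod_cast card_memberSubfamily_add_card_nonMemberSubfamily a B
    have cA' : ((A0 ∪ A1).card : ℝ) + (A0 ∩ A1).card = A.card := by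
      rw [← cA, add_comm (A1.card : ℝ)]
      exact_mod_cast card_union_add_card_inter A0 A1
    have cB' : ((B0 ∪ B1).card : ℝ) + (B0 ∩ B1).card = B.card := by
      rw [← cB, add_comm (B1.card : ℝ)]
      exact_mod_cast card_union_add_card_inter B0 B1
    have iuA : ((A0 ∩ A1).card : ℝ) ≤ (A0 ∪ A1).card := by
      exact_mod_cast card_le_card (inter_subset_left.trans subset_union_left)
    have iuB : ((B0 ∩ B1).card : ℝ) ≤ (B0 ∪ B1).card := by
      exact_mod_cast card_le_card (inter_subset_left.trans subset_union_left)
    have gain : ∀ A' B' : Finset (Finset α),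
        (A'.card : ℝ) * B'.card ≤ 4 ^ s.card * avoidBound β K (s.card - N₀) (u + 1) →
        (1 + β) * ((A.card : ℝ) * B.card) ≤ 4 * ((A'.card : ℝ) * B'.card) →
        (A.card : ℝ) * B.card ≤ 4 ^ (s.card + 1) * avoidBound β K (s.card - N₀ + 1) (u + 1) := by
      intro A' B' h1 h2
      have h3 := avoidBound_le_mul_succ hβ.le hK0 (s.card - N₀) (u + 1)
      have h4 : (4 : ℝ) ^ s.card * avoidBound β K (s.card - N₀) (u + 1) ≤
          4 ^ s.card * ((1 + β) * avoidBound β K (s.card - N₀ + 1) (u + 1)) := by gcongr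
      refine le_of_mul_le_mul_left (a := 1 + β) ?_ (by linarith)
      rw [pow_succ]
      linarith
    have loss : ∀ A' B' : Finset (Finset α),
        (A'.card : ℝ) * B'.card ≤ 4 ^ s.card * avoidBound β K (s.card - N₀) u →
        (A.card : ℝ) * B.card ≤ (1 + β) ^ 5 * (4 * ((A'.card : ℝ) * B'.card)) →
        (A.card : ℝ) * B.card ≤ 4 ^ (s.card + 1) * avoidBound β K (s.card - N₀ + 1) (u + 1) := by
      intro A' B' h1 h2
      rw [← pow_mul_avoidBound hβ.le]
      calc (A.card : ℝ) * B.card ≤ (1 + β) ^ 5 * (4 * ((A'.card : ℝ) * B'.card)) := h2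
        _ ≤ (1 + β) ^ 5 * (4 * (4 ^ s.card * avoidBound β K (s.card - N₀) u)) := by gcongr
        _ = _ := by ring
    rcases density_alternative hβ hβ' hloss (Nat.cast_nonneg A.card) (Nat.cast_nonneg B.card)
      cA' cA cB' cB (by positivity) iuA (by positivity) iuB (by positivity) with h | h | h | h | h
    · refine gain (A0 ∪ A1) B0 (ih _ _ (union_subset hA0 hA1) hB0 l e (u + 1) (by omega) (by omega)
        heu (by omega) hlN ?_) h
      intro x hx y hy
      rcases mem_union.1 hx with hx | hx
      · exact avoid00 x hx y hy
      · exact avoid10 x hx y hy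
    · refine gain A0 (B0 ∪ B1) (ih _ _ hA0 (union_subset hB0 hB1) l e (u + 1) (by omega) (by omega)
        heu (by omega) hlN ?_) h
      intro x hx y hy
      rcases mem_union.1 hy with hy | hy
      · exact avoid00 x hx y hy
      · exact avoid01 x hx y hy
    · refine gain A1 B1 (ih _ _ hA1 hB1 (l - 1) e (u + 1) (by omega) (by omega)
        heu (by omega) (by omega) ?_) h
      intro x hx y hy
      have := avoid11 x hx y hy
      omega
    · refine loss (A0 ∩ A1) B1 (ih _ _ (inter_subset_left.trans hA0) hB1 l (e + 1) u (by omega)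
        (by omega) (by omega) (by omega) hlN ?_) h
      intro x hx y hy
      have h1 := avoid01 x (mem_inter.1 hx).1 y hy
      have h2 := avoid11 x (mem_inter.1 hx).2 y hy
      omega
    · refine loss A1 (B0 ∩ B1) (ih _ _ hA1 (inter_subset_left.trans hB0) l (e + 1) u (by omega)
        (by omega) (by omega) (by omega) hlN ?_) h
      intro x hx y hy
      have h1 := avoid10 x hx y (mem_inter.1 hy).1
      have h2 := avoid11 x hx y (mem_inter.1 hy).2
      omega

theorem card_symmDiff_add_two_mul_card_inter {α : Type*} [DecidableEq α] (x y : Finset α) :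
    (symmDiff x y).card + 2 * (x ∩ y).card = x.card + y.card := by
  have h1 := card_sdiff_add_card_inter x y
  have h2 := card_sdiff_add_card_inter y x
  have h3 : (symmDiff x y).card = (x \ y).card + (y \ x).card :=
    card_union_of_disjoint disjoint_sdiff_sdiff
  rw [inter_comm y x] at h2
  omega

/-- A small family of unbiased representatives for the balanced bicolorings yields a dense uniform
family of sets with a forbidden intersection size. -/
theorem exists_dense_avoiding_family {n r : ℕ} (hn : 4 ∣ n) (hr : Even r) (hr2 : Odd (r / 2))
    {𝒜 : Finset (Finset (Fin n))} (hcard : ∀ A ∈ 𝒜, A.card = r)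
    (h𝒜 : ∀ P : Finset (Fin n), P.card = n / 2 → ∃ A ∈ 𝒜, (A ∩ P).card = (A ∩ Pᶜ).card) :
    ∃ (F : Finset (Finset (Fin n))) (w : ℕ),
      (2 : ℝ) ^ n / (2 ^ 𝒜.card * (n + 1)) ≤ F.card ∧ (∀ a ∈ F, a.card = w) ∧
      ∀ a ∈ F, ∀ b ∈ F, (a ∩ b).card + n / 4 ≠ w := by
  classical
  let f : Finset (Fin n) → Finset (Finset (Fin n)) × ℕ :=
    fun P => (𝒜.filter fun A => Odd (A ∩ P).card, P.card)
  have hmaps : ∀ P ∈ (univ : Finset (Finset (Fin n))),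
      f P ∈ 𝒜.powerset ×ˢ range (n + 1) := by
    intro P _
    have := card_le_univ P
    rw [Fintype.card_fin] at this
    simp only [f, mem_product, mem_powerset, mem_range, filter_subset, true_and]
    omega
  obtain ⟨⟨T, w⟩, -, hF⟩ := exists_le_card_fiber_of_nsmul_le_card_of_maps_to
    (b := (2 : ℝ) ^ n / (2 ^ 𝒜.card * (n + 1))) hmaps ⟨(∅, 0), by simp⟩ (by
      rw [card_product, card_powerset, card_range, nsmul_eq_mul]
      push_cast
      rw [mul_div_cancel₀ _ (by positivity)]
      simp)
  refine ⟨_, w, hF, ?_, ?_⟩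
  · intro a ha
    rw [mem_filter] at ha
    exact congrArg Prod.snd ha.2
  · intro a ha b hb hab
    rw [mem_filter] at ha hb
    have ha1 : (𝒜.filter fun A => Odd (A ∩ a).card) = T := congrArg Prod.fst ha.2
    have hb1 : (𝒜.filter fun A => Odd (A ∩ b).card) = T := congrArg Prod.fst hb.2
    have ha2 : a.card = w := congrArg Prod.snd ha.2
    have hb2 : b.card = w := congrArg Prod.snd hb.2
    have hs := card_symmDiff_add_two_mul_card_inter a b
    obtain ⟨A, hA, hAP⟩ := h𝒜 (symmDiff a b) (by omega)
    have hsum : (A ∩ symmDiff a b).card + (A ∩ (symmDiff a b)ᶜ).card = r := by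
      rw [← hcard A hA, ← sdiff_eq_inter_compl, add_comm]
      exact card_sdiff_add_card_inter _ _
    have hpar := card_symmDiff_add_two_mul_card_inter (A ∩ a) (A ∩ b)
    have heq : symmDiff (A ∩ a) (A ∩ b) = A ∩ symmDiff a b := (inf_symmDiff_distrib_left _ _ _).symm
    have hiff : Odd (A ∩ a).card ↔ Odd (A ∩ b).card := by
      have : A ∈ (𝒜.filter fun A => Odd (A ∩ a).card) ↔
          A ∈ (𝒜.filter fun A => Odd (A ∩ b).card) := by rw [ha1, hb1]
      simpa [hA] using this
    rw [heq] at hpar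
    simp only [Nat.odd_iff] at hiff hr2
    obtain ⟨c, hc⟩ := hr
    omega

/-- A uniform family with a suitable forbidden intersection size is not dense, given numerical
conditions on the parameters. -/
theorem dense_family_contradiction {β q : ℝ} {n m κ w : ℕ} (hβ : 0 < β) (hβ' : β ≤ 1 / 10)
    (hloss : 1 ≤ (1 - 4 * β) * (1 + β) ^ 5) (hq : 1 ≤ q) (hbq : (1 + β) ^ 40 ≤ q)
    (hQ : ((1 + q) ^ 2 / (4 * q)) ^ 1000 ≤ 1 + β) (hn : 4 ∣ n) (hκ : κ = n / 1000) (hκ1 : 1 ≤ κ)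
    (hm : (4 : ℝ) ^ m ≤ (1 + β) ^ κ) (hbig : 17 * (n + 1 : ℝ) ^ 2 < (1 + β) ^ κ)
    {F : Finset (Finset (Fin n))} (hF : (2 : ℝ) ^ n / (2 ^ m * (n + 1)) ≤ F.card)
    (hw : ∀ a ∈ F, a.card = w) (havoid : ∀ a ∈ F, ∀ b ∈ F, (a ∩ b).card + n / 4 ≠ w) :
    False := by
  have hq0 : 0 < q := by linarith
  set b := 1 + β with hb
  have hb1 : 1 ≤ b := by linarith
  have hb0 : 0 < b := by linarith
  set Q := (1 + q) ^ 2 / (4 * q) with hQd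
  have hQ1 : 1 ≤ Q := by
    rw [hQd, le_div_iff₀ (by positivity)]
    nlinarith [sq_nonneg (1 - q)]
  have hQn : ∀ N ≤ n, Q ^ N ≤ b ^ (κ + 1) := by
    intro N hN
    calc Q ^ N ≤ Q ^ (1000 * (κ + 1)) := pow_le_pow_right₀ hQ1 (by omega)
      _ = (Q ^ 1000) ^ (κ + 1) := pow_mul _ _ _
      _ ≤ b ^ (κ + 1) := by gcongr
  have hqκ : b ^ (40 * κ) ≤ q ^ κ := by
    rw [pow_mul]
    gcongr
  have hn1 : (1 : ℝ) ≤ n + 1 := by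
    have : (0 : ℝ) ≤ n := Nat.cast_nonneg n
    linarith
  have hFpos : (0 : ℝ) < F.card := lt_of_lt_of_le (by positivity) hF
  have hF' : (2 : ℝ) ^ n ≤ F.card * (2 ^ m * (n + 1)) := by
    rwa [div_le_iff₀ (by positivity)] at hF
  have h4n : (4 : ℝ) ^ n = 2 ^ n * 2 ^ n := by
    rw [← mul_pow]
    norm_num
  have hsub : F ⊆ (univ : Finset (Fin n)).powerset := by
    rw [powerset_univ]
    exact subset_univ F
  have hcardu : (univ : Finset (Fin n)).card = n := by simp
  have hden : 8 * ((1 + q) ^ 2 / q) ^ n < 2 ^ n * F.card * q ^ κ := by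
    have h1 : ((1 + q) ^ 2 / q) = 4 * Q := by
      rw [hQd]
      field_simp
    have h2 : (2 : ℝ) ^ m ≤ b ^ κ := le_trans (by gcongr; norm_num) hm
    have h3 : 8 * Q ^ n * (2 ^ m * (n + 1)) < q ^ κ := by
      calc 8 * Q ^ n * (2 ^ m * (n + 1)) ≤ 8 * b ^ (κ + 1) * (b ^ κ * (n + 1)) := by
            gcongr
            exact hQn n le_rfl
        _ = (8 * b * (n + 1)) * b ^ (2 * κ) := by ring
        _ < b ^ κ * b ^ (2 * κ) := by
            gcongr
            nlinarith
        _ = b ^ (3 * κ) := by ring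
        _ ≤ b ^ (40 * κ) := pow_le_pow_right₀ hb1 (by omega)
        _ ≤ q ^ κ := hqκ
    rw [h1, mul_pow, h4n]
    calc 8 * (2 ^ n * 2 ^ n * Q ^ n) ≤ 8 * (2 ^ n * (F.card * (2 ^ m * (n + 1))) * Q ^ n) := by
          gcongr
      _ = 2 ^ n * F.card * (8 * Q ^ n * (2 ^ m * (n + 1))) := by ring
      _ < 2 ^ n * F.card * q ^ κ := by gcongr
  obtain ⟨x, a, ha, -, -, hxa, -, hx1, hx2⟩ := exists_near_translate (κ := κ) (l := n / 2) hq
    (empty_subset (univ : Finset (Fin n))) (by rw [sdiff_empty, hcardu]; omega) hsub hsub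
    (by rwa [hcardu]) (by rwa [hcardu])
  rw [sdiff_empty] at hx1 hx2
  have h5 := card_sdiff_le_add_card_symmDiff x a ∅
  have h6 := card_sdiff_le_add_card_symmDiff a x ∅
  rw [symmDiff_comm] at h6
  simp only [sdiff_empty, hw a ha] at h5 h6
  have hmain := card_mul_card_le_avoidBound (K := 8 * b ^ (κ + 1) / q ^ κ) (N₀ := n - 72 * κ)
    (n := n) hβ hβ' hloss hq (fun N hN => by gcongr; exact hQn N hN) univ F F hsub hsub
    (w - n / 4) 0 (6 * κ) (by omega) (by omega) (by omega) (by omega) (by omega) (by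
      intro a ha b hb h
      have := havoid a ha b hb
      omega)
  rw [hcardu, show n - (n - 72 * κ) = 72 * κ by omega] at hmain
  have hbound : avoidBound β (8 * b ^ (κ + 1) / q ^ κ) (72 * κ) (6 * κ) * b ^ (9 * κ) ≤ 17 := by
    unfold avoidBound
    rw [← hb, add_mul]
    have h7 : 8 * b ^ (κ + 1) / q ^ κ * b ^ (5 * (6 * κ)) * b ^ (9 * κ) ≤ 8 * b := by
      calc 8 * b ^ (κ + 1) / q ^ κ * b ^ (5 * (6 * κ)) * b ^ (9 * κ)
          = 8 * b * b ^ (40 * κ) / q ^ κ := by ring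
        _ ≤ 8 * b := by
          rw [div_le_iff₀ (by positivity)]
          gcongr
    have h8 : b ^ (6 * (6 * κ)) / b ^ (72 * κ) * b ^ (9 * κ) ≤ 1 := by
      rw [div_mul_eq_mul_div, div_le_one (by positivity), ← pow_add]
      exact pow_le_pow_right₀ hb1 (by omega)
    linarith
  set Ψ := avoidBound β (8 * b ^ (κ + 1) / q ^ κ) (72 * κ) (6 * κ) with hΨ
  have hΨ0 : 0 ≤ Ψ := by
    rw [hΨ]
    unfold avoidBound
    positivity
  have h9 : (4 : ℝ) ^ n ≤ 4 ^ n * (Ψ * (4 ^ m * (n + 1) ^ 2)) := by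
    calc (4 : ℝ) ^ n = 2 ^ n * 2 ^ n := h4n
      _ ≤ (F.card * (2 ^ m * (n + 1))) * (F.card * (2 ^ m * (n + 1))) := by gcongr
      _ = (F.card * F.card) * ((2 ^ m * 2 ^ m) * (n + 1) ^ 2) := by ring
      _ = (F.card * F.card) * (4 ^ m * (n + 1) ^ 2) := by
        rw [← mul_pow]
        norm_num
      _ ≤ 4 ^ n * Ψ * (4 ^ m * (n + 1) ^ 2) := by gcongr
      _ = _ := by ring
  have h10 : 1 ≤ Ψ * (4 ^ m * (n + 1) ^ 2) :=
    le_of_mul_le_mul_left (by simpa using h9) (by positivity : (0 : ℝ) < 4 ^ n)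
  have h11 : b ^ (9 * κ) ≤ b ^ κ * b ^ κ * 1 := by
    calc b ^ (9 * κ) ≤ Ψ * (4 ^ m * (n + 1) ^ 2) * b ^ (9 * κ) :=
          le_mul_of_one_le_left (by positivity) h10
      _ = (Ψ * b ^ (9 * κ)) * (4 ^ m * (n + 1) ^ 2) := by ring
      _ ≤ 17 * (b ^ κ * (n + 1) ^ 2) := by gcongr
      _ = b ^ κ * (17 * (n + 1) ^ 2) := by ring
      _ ≤ b ^ κ * b ^ κ * 1 := by
        rw [mul_one]
        gcongr
  have h12 : b ^ κ * b ^ κ * 1 < b ^ (9 * κ) := by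
    rw [mul_one, ← pow_add]
    exact pow_lt_pow_right₀ (by linarith) (by omega)
  linarith

theorem exists_forall_sq_lt_pow {b : ℝ} (hb : 1 < b) :
    ∃ k₀ : ℕ, ∀ k ≥ k₀, 17 * (1000 * ((k : ℝ) + 1)) ^ 2 < b ^ k := by
  have h := (tendsto_pow_const_div_const_pow_of_one_lt 2 hb).comp (Filter.tendsto_add_atTop_nat 1)
  have h2 := h.eventually_lt_const (u := 1 / (17000000 * b)) (by positivity)
  obtain ⟨k₀, hk₀⟩ := Filter.eventually_atTop.1 h2
  refine ⟨k₀, fun k hk => ?_⟩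
  have := hk₀ k hk
  simp only [Function.comp_apply] at this
  rw [div_lt_div_iff₀ (by positivity) (by positivity), pow_succ b] at this
  push_cast at this
  have hb0 : 0 < b := by linarith
  refine lt_of_mul_lt_mul_right (a := b) ?_ hb0.le
  linarith

theorem exists_card_inter_eq_card_inter_compl {n r : ℕ} (hn : 2 ∣ n) (hr : Even r) (hrn : r ≤ n)
    {P : Finset (Fin n)} (hP : P.card = n / 2) :
    ∃ A : Finset (Fin n), A.card = r ∧ (A ∩ P).card = (A ∩ Pᶜ).card := by
  have hPc : Pᶜ.card = n / 2 := by
    rw [card_compl, Fintype.card_fin]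
    omega
  obtain ⟨c, hc⟩ := hr
  obtain ⟨X, hX, hXc⟩ := exists_subset_card_eq (s := P) (n := c) (by omega)
  obtain ⟨Y, hY, hYc⟩ := exists_subset_card_eq (s := Pᶜ) (n := c) (by omega)
  have hX' : (X ∪ Y) ∩ P = X := by
    ext i
    have h1 := @hX i
    have h2 := @hY i
    simp only [mem_compl, mem_inter, mem_union] at *
    tauto
  have hY' : (X ∪ Y) ∩ Pᶜ = Y := by
    ext i
    have h1 := @hX i
    have h2 := @hY i
    simp only [mem_compl, mem_inter, mem_union] at *
    tauto
  refine ⟨X ∪ Y, ?_, by rw [hX', hY', hXc, hYc]⟩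
  rw [card_union_of_disjoint (disjoint_compl_right.mono hX hY)]
  omega

theorem exists_mul_le_gammaE :
    ∃ δ : ℝ, 0 < δ ∧ δ < 1 ∧
      ∀ n r : ℕ, 0 < n → 4 ∣ n → Even r → 2 ≤ r → r ≤ n → Odd (r / 2) →
        δ * n ≤ (gammaE n (n / 2) r : ℝ) := by
  set β : ℝ := 1 / 10 ^ 7 with hβd
  set q : ℝ := 1 + 50 / 10 ^ 7 with hqd
  have hβ : 0 < β := by norm_num [hβd]
  obtain ⟨k₀, hk₀⟩ := exists_forall_sq_lt_pow (b := 1 + β) (by linarith)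
  obtain ⟨E, hE⟩ := pow_unbounded_of_one_lt (4 : ℝ) (by linarith : 1 < 1 + β)
  have hD : (1 : ℝ) ≤ ((E + k₀ + 1 : ℕ) : ℝ) := by exact_mod_cast Nat.le_add_left 1 _
  refine ⟨1 / (1000 * ((E + k₀ + 1 : ℕ) : ℝ)), by positivity, ?_, ?_⟩
  · rw [div_lt_one (by positivity)]
    linarith
  intro n r hn h4 hr _ hrn hr2
  have hne : {m | ∃ 𝒜 : Finset (Finset (Fin n)), 𝒜.card = m ∧ (∀ A ∈ 𝒜, A.card = r) ∧
      (∀ P : Finset (Fin n), P.card = n / 2 →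
        ∃ A ∈ 𝒜, (A ∩ P).card = (A ∩ Pᶜ).card)}.Nonempty := by
    refine ⟨_, univ.filter fun A => A.card = r, rfl, by simp, fun P hP => ?_⟩
    obtain ⟨A, hA, hAP⟩ :=
      exists_card_inter_eq_card_inter_compl ((by norm_num : 2 ∣ 4).trans h4) hr hrn hP
    exact ⟨A, by simpa using hA, hAP⟩
  obtain ⟨𝒜, hm, hcard, h𝒜⟩ := Nat.sInf_mem hne
  change 𝒜.card = gammaE n (n / 2) r at hm
  rw [← hm]
  by_contra hcon
  push Not at hcon
  have hpos : 1 ≤ 𝒜.card := by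
    obtain ⟨P, -, hP⟩ := exists_subset_card_eq (s := (univ : Finset (Fin n))) (n := n / 2)
      (by rw [card_fin]; omega)
    obtain ⟨A, hA, -⟩ := h𝒜 P hP
    exact card_pos.2 ⟨A, hA⟩
  have hlt : 1000 * (E + k₀ + 1) * 𝒜.card < n := by
    rw [div_mul_eq_mul_div, one_mul, lt_div_iff₀ (by positivity)] at hcon
    have : ((1000 * (E + k₀ + 1) * 𝒜.card : ℕ) : ℝ) < n := by
      push_cast at hcon ⊢
      linarith
    exact_mod_cast this
  have hle : (E + k₀ + 1) * 𝒜.card ≤ n / 1000 := by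
    rw [Nat.le_div_iff_mul_le (by norm_num)]
    linarith
  have hle1 : E + k₀ + 1 ≤ n / 1000 := le_trans (Nat.le_mul_of_pos_right _ hpos) hle
  have hle2 : E * 𝒜.card ≤ n / 1000 :=
    le_trans (Nat.mul_le_mul_right _ (by omega)) hle
  obtain ⟨F, w, hF, hw, havoid⟩ := exists_dense_avoiding_family h4 hr hr2 hcard h𝒜
  refine dense_family_contradiction (β := β) (q := q) hβ (by norm_num [hβd]) (by norm_num [hβd])
    (by norm_num [hqd]) (by norm_num [hβd, hqd]) ?_ h4 rfl (by omega) ?_ ?_ hF hw havoid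
  · have h1 : (1 + q) ^ 2 / (4 * q) ≤ 1 + 1 / 10 ^ 11 := by norm_num [hqd]
    calc ((1 + q) ^ 2 / (4 * q)) ^ 1000 ≤ (1 + 1 / 10 ^ 11) ^ 1000 := by gcongr
      _ = ((1 + 1 / 10 ^ 11) ^ 100) ^ 10 := by rw [← pow_mul]
      _ ≤ (1 + 1 / 10 ^ 8 / 2) ^ 10 := by
        gcongr ?_ ^ 10
        norm_num
      _ ≤ 1 + β := by norm_num [hβd]
  · calc (4 : ℝ) ^ 𝒜.card ≤ ((1 + β) ^ E) ^ 𝒜.card := by gcongr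
      _ = (1 + β) ^ (E * 𝒜.card) := (pow_mul _ _ _).symm
      _ ≤ (1 + β) ^ (n / 1000) := pow_le_pow_right₀ (by linarith) hle2
  · refine lt_of_le_of_lt ?_ (hk₀ (n / 1000) (by omega))
    have : n + 1 ≤ 1000 * (n / 1000 + 1) := by omega
    gcongr
    exact_mod_cast this

end

/-- Corollary 1: there is a constant `0 < δ < 1` such that for every `n` with `n/2` even
(i.e. `4 ∣ n`) and every even `r`, `2 ≤ r ≤ n`, with `r/2` odd, `γ(n, n/2, r) ≥ δn`. -/
theorem stmt_17 :
    ∃ δ : ℝ, 0 < δ ∧ δ < 1 ∧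
      ∀ n r : ℕ, 0 < n → 4 ∣ n → Even r → 2 ≤ r → r ≤ n → Odd (r / 2) →
        δ * n ≤ (gammaE n (n / 2) r : ℝ) := by
  exact exists_mul_le_gammaE
end

section
/- Let n be a positive integer divisible by 4 (so that n/2 is even). Then γ(n, n/2, n/2) ≤ n/2. Concretely, the family of the n/2 intervals A_i = {i, i+1, …, i + n/2 − 1} for i = 1, …, n/2 is a system of unbiased representatives for the set of all n/2-bicolorings of [n]: for every bicoloring B of [n] with equally many +1's and −1's there is an index i with |A_i ∩ B(+1)| = |A_i ∩ B(−1)|. -/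
/-- Discrete intermediate value theorem for integer sequences with steps at most `1`. -/
theorem exists_eq_zero_of_abs_step_le_one (f : ℕ → ℤ) (hf : ∀ i, |f (i + 1) - f i| ≤ 1) :
    ∀ N : ℕ, f 0 ≤ 0 → 0 ≤ f N → ∃ i ≤ N, f i = 0
  | 0, h0, hN => ⟨0, le_rfl, le_antisymm h0 hN⟩
  | N + 1, h0, hN => by
    rcases le_or_gt 0 (f N) with h | h
    · obtain ⟨i, hi, hfi⟩ := exists_eq_zero_of_abs_step_le_one f hf N h0 h
      exact ⟨i, by omega, hfi⟩
    · have := abs_le.mp (hf N)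
      exact ⟨N + 1, le_rfl, by omega⟩

/-- The window `{i, …, i + h - 1}` in `Fin n`. -/
def finWindow (n h i : ℕ) : Finset (Fin n) :=
  Finset.univ.filter (fun j : Fin n => i ≤ (j : ℕ) ∧ (j : ℕ) < i + h)

/-- The number of elements of `P` below `k`. -/
def finCountBelow {n : ℕ} (P : Finset (Fin n)) (k : ℕ) : ℕ :=
  (P.filter (fun j : Fin n => (j : ℕ) < k)).card

theorem card_finWindow_inter_add {n : ℕ} (P : Finset (Fin n)) (h i : ℕ) :
    (finWindow n h i ∩ P).card + finCountBelow P i = finCountBelow P (i + h) := by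
  unfold finCountBelow finWindow
  rw [← Finset.card_union_of_disjoint]
  · congr 1
    ext j
    simp only [Finset.mem_union, Finset.mem_inter, Finset.mem_filter, Finset.mem_univ, true_and]
    by_cases hj : j ∈ P <;> simp only [hj, true_and, false_and, and_true, and_false, or_false]
    omega
  · rw [Finset.disjoint_left]
    intro j
    simp only [Finset.mem_inter, Finset.mem_filter, Finset.mem_univ, true_and]
    omega

theorem finCountBelow_mono {n : ℕ} (P : Finset (Fin n)) : Monotone (finCountBelow P) :=
  fun _ _ hab => Finset.card_le_card
    (Finset.monotone_filter_right P fun _ _ hj => lt_of_lt_of_le hj hab)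

theorem finCountBelow_succ_le {n : ℕ} (P : Finset (Fin n)) (k : ℕ) :
    finCountBelow P (k + 1) ≤ finCountBelow P k + 1 := by
  rw [← card_finWindow_inter_add P 1 k, add_comm]
  refine Nat.add_le_add_left (Finset.card_le_one.mpr fun a ha b hb => ?_) _
  simp only [finWindow, Finset.mem_inter, Finset.mem_filter, Finset.mem_univ, true_and] at ha hb
  omega

theorem finCountBelow_zero {n : ℕ} (P : Finset (Fin n)) : finCountBelow P 0 = 0 := by
  simp [finCountBelow]

theorem finCountBelow_self {n : ℕ} (P : Finset (Fin n)) : finCountBelow P n = P.card := by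
  simp [finCountBelow]

theorem card_finWindow {n h i : ℕ} (hi : i + h ≤ n) : (finWindow n h i).card = h := by
  have key := card_finWindow_inter_add (Finset.univ : Finset (Fin n)) h i
  simp only [finCountBelow, Finset.inter_univ, Fin.card_filter_val_lt] at key
  omega

theorem exists_finWindow_unbiased {m : ℕ} (hm : 0 < m) (P : Finset (Fin (4 * m)))
    (hP : P.card = 2 * m) :
    ∃ i < 2 * m, (finWindow (4 * m) (2 * m) i ∩ P).card =
      (finWindow (4 * m) (2 * m) i ∩ Pᶜ).card := by
  set f : ℕ → ℤ := fun i => ((finWindow (4 * m) (2 * m) i ∩ P).card : ℤ) - m with hf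
  have hstep : ∀ i, |f (i + 1) - f i| ≤ 1 := fun i => by
    have h1 := card_finWindow_inter_add P (2 * m) i
    have h2 := card_finWindow_inter_add P (2 * m) (i + 1)
    rw [Nat.add_right_comm] at h2
    have h3 := finCountBelow_succ_le P i
    have h4 := finCountBelow_succ_le P (i + 2 * m)
    have h5 := finCountBelow_mono P (Nat.le_succ i)
    have h6 := finCountBelow_mono P (Nat.le_succ (i + 2 * m))
    rw [Nat.succ_eq_add_one] at h5 h6
    simp only [hf, abs_le]
    omega
  have hends : f 0 + f (2 * m) = 0 := by
    have h1 := card_finWindow_inter_add P (2 * m) 0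
    have h2 := card_finWindow_inter_add P (2 * m) (2 * m)
    rw [finCountBelow_zero, Nat.zero_add] at h1
    rw [show 2 * m + 2 * m = 4 * m by ring, finCountBelow_self, hP] at h2
    simp only [hf]
    omega
  have hzero : ∃ i ≤ 2 * m, f i = 0 := by
    rcases le_total (f 0) 0 with h | h
    · exact exists_eq_zero_of_abs_step_le_one f hstep _ h (by omega)
    · obtain ⟨i, hi, hfi⟩ := exists_eq_zero_of_abs_step_le_one (fun i => -f i)
        (fun i => by rw [← abs_neg]; convert hstep i using 2; ring) (2 * m) (by omega) (by omega)
      exact ⟨i, hi, neg_eq_zero.mp hfi⟩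
  obtain ⟨i, hi, hfi⟩ : ∃ i < 2 * m, f i = 0 := by
    obtain ⟨i, hi, hfi⟩ := hzero
    rcases hi.lt_or_eq with hlt | rfl
    · exact ⟨i, hlt, hfi⟩
    · exact ⟨0, by omega, by omega⟩
  refine ⟨i, hi, ?_⟩
  have hcard := card_finWindow (n := 4 * m) (h := 2 * m) (i := i) (by omega)
  have hsplit := Finset.card_inter_add_card_sdiff (finWindow (4 * m) (2 * m) i) P
  rw [Finset.sdiff_eq_inter_compl] at hsplit
  simp only [hf] at hfi
  omega

/-- Lemma 4: for `n` divisible by 4 (so `n/2` is even), `γ(n, n/2, n/2) ≤ n/2`; concretely,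
the `n/2` sliding windows of length `n/2` (the windows `{i, i+1, …, i+n/2-1}`, indexed here
0-based) form a system of unbiased representatives for all `n/2`-bicolorings of `[n]`. -/
theorem stmt_18 (n : ℕ) (hn : 0 < n) (h4 : 4 ∣ n) :
    gammaE n (n / 2) (n / 2) ≤ n / 2 ∧
    ∀ P : Finset (Fin n), P.card = n / 2 →
      ∃ i < n / 2,
        ((Finset.univ.filter (fun j : Fin n => i ≤ (j : ℕ) ∧ (j : ℕ) < i + n / 2)) ∩ P).card =
        ((Finset.univ.filter (fun j : Fin n => i ≤ (j : ℕ) ∧ (j : ℕ) < i + n / 2)) ∩ Pᶜ).card := by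
  obtain ⟨m, rfl⟩ := h4
  have hm : 0 < m := by omega
  rw [show 4 * m / 2 = 2 * m by omega]
  refine ⟨?_, fun P hP => exists_finWindow_unbiased hm P hP⟩
  refine le_trans (Nat.sInf_le
    ⟨(Finset.range (2 * m)).image (finWindow (4 * m) (2 * m)), rfl, ?_, fun P hP => ?_⟩)
    (Finset.card_image_le.trans_eq (Finset.card_range _))
  · simp only [Finset.forall_mem_image, Finset.mem_range]
    exact fun i hi => card_finWindow (by omega)
  · obtain ⟨i, hi, h⟩ := exists_finWindow_unbiased hm P hP
    exact ⟨_, Finset.mem_image_of_mem _ (Finset.mem_range.mpr hi), h⟩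
end

section
/- Let n, k be positive integers and let c be an odd positive integer. Let 𝒜 be a family of subsets of [n], each of cardinality 2c, such that for every k-element subset C ⊆ [n] there exists A ∈ 𝒜 with |C ∩ A| = c. Let V ⊆ 𝔽₂ⁿ be the 𝔽₂-linear span of the indicator vectors of the sets in 𝒜, and let V^⊥ be its orthogonal complement with respect to the standard bilinear form over 𝔽₂. Then V^⊥ contains no vector of Hamming weight k; in particular the indicator vector of every k-element subset of [n] lies outside V^⊥, and V^⊥ is a k-avoiding binary code (the sum of any two of its elements never has Hamming weight k). -/
/-- The standard pairing of `x` with the indicator vector of `A` over `𝔽₂` counts, modulo `2`,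
the points of `A` in the support of `x`. -/
theorem sum_mul_indicator_eq_card_support_inter {ι : Type*} [Fintype ι] [DecidableEq ι]
    (x : ι → ZMod 2) (A : Finset ι) :
    ∑ i, x i * (if i ∈ A then (1 : ZMod 2) else 0) =
      ((Finset.univ.filter (fun i => x i ≠ 0) ∩ A).card : ZMod 2) := by
  have eq_ite : ∀ a : ZMod 2, a = if a ≠ 0 then 1 else 0 := by decide
  rw [Finset.card_eq_sum_ones, Nat.cast_sum, ← Finset.filter_mem_eq_inter, Finset.filter_filter,
    Finset.sum_filter]
  refine Finset.sum_congr rfl fun i _ => ?_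
  rw [eq_ite (x i)]
  by_cases hx : x i = 0 <;> by_cases hi : i ∈ A <;> simp [hx, hi]

/-- Lemma (vector space step of Theorem 4): let `c` be odd and let `𝒜` be a family of
`2c`-element subsets of `[n]` such that every `k`-element subset `C` of `[n]` has some
`A ∈ 𝒜` with `|C ∩ A| = c`.  Let `V ≤ 𝔽₂ⁿ` be the span of the indicator vectors of the
members of `𝒜` and let `V^⊥` be its orthogonal complement for the standard bilinear form.
Then no vector of `V^⊥` has Hamming weight `k`, and `V^⊥` is a `k`-avoiding code: the sum
of any two of its elements never has Hamming weight `k`. -/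
theorem stmt_19 (n k c : ℕ) (hk : 0 < k) (hkn : k ≤ n) (hc : Odd c)
    (𝒜 : Finset (Finset (Fin n)))
    (hA : ∀ A ∈ 𝒜, A.card = 2 * c)
    (hrep : ∀ C : Finset (Fin n), C.card = k → ∃ A ∈ 𝒜, (C ∩ A).card = c)
    (V : Submodule (ZMod 2) (Fin n → ZMod 2))
    (hV : V = Submodule.span (ZMod 2)
      ((fun A : Finset (Fin n) => (fun i => if i ∈ A then (1 : ZMod 2) else 0)) ''
        (𝒜 : Set (Finset (Fin n)))))
    (Vperp : Set (Fin n → ZMod 2))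
    (hVperp : Vperp = {x | ∀ y ∈ V, ∑ i, x i * y i = 0}) :
    (∀ x ∈ Vperp, (Finset.univ.filter (fun i => x i ≠ 0)).card ≠ k) ∧
    (∀ x ∈ Vperp, ∀ y ∈ Vperp,
      (Finset.univ.filter (fun i => (x + y) i ≠ 0)).card ≠ k) := by
  subst hV hVperp
  have weight_ne : ∀ x : Fin n → ZMod 2,
      (∀ y ∈ Submodule.span (ZMod 2)
        ((fun A : Finset (Fin n) => (fun i => if i ∈ A then (1 : ZMod 2) else 0)) ''
          (𝒜 : Set (Finset (Fin n)))), ∑ i, x i * y i = 0) →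
      (Finset.univ.filter (fun i => x i ≠ 0)).card ≠ k := by
    intro x hx hcard
    obtain ⟨A, hA𝒜, hAc⟩ := hrep _ hcard
    have h := hx _ (Submodule.subset_span ⟨A, hA𝒜, rfl⟩)
    rw [sum_mul_indicator_eq_card_support_inter, hAc, ZMod.natCast_eq_zero_iff_even] at h
    exact Nat.not_even_iff_odd.mpr hc h
  refine ⟨weight_ne, fun x hx y hy => weight_ne (x + y) fun z hz => ?_⟩
  simp only [Pi.add_apply, add_mul, Finset.sum_add_distrib]
  rw [hx z hz, hy z hz, add_zero]
end
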